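/- arXiv:1310.6202 — 6 statements merged into one kernel-verified Lean document; each statement's English description precedes it below -/
import Mathlib

section
/- Let X be a real or complex Banach space and let C : ℝ → B(X) be a strongly continuous cosine family on X, and let a ≥ 0. If there exists r < 1 such that ‖C(t) − cos(at)·I‖ ≤ r for all t ≥ 0 (i.e. sup_{t≥0} ‖C(t) − cos(at)·I‖ < 1), then C(t) = cos(at)·I for all t ≥ 0. -/
open Filter Topology

section CosineSequences

variable {𝕜 : Type*} [RCLike 𝕜] {A : Type*} [NormedRing A] [NormedAlgebra 𝕜 A]

/-- The functional equation satisfied by the difference of a cosine family and a scalar one. -/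
lemma cosine_sub_cos_add_add_sub (C : ℝ → A)
    (hC : ∀ s t : ℝ, (2 : 𝕜) • (C s * C t) = C (s + t) + C (s - t)) (a : ℝ) (D : ℝ → A)
    (hD : ∀ t, D t = C t - ((Real.cos (a * t) : ℝ) : 𝕜) • (1 : A)) (s t : ℝ) :
    D (s + t) + D (s - t) = (2 : 𝕜) • (D s * D t)
      + (2 * ((Real.cos (a * s) : ℝ) : 𝕜)) • D t + (2 * ((Real.cos (a * t) : ℝ) : 𝕜)) • D s := by
  have hcos : ((Real.cos (a * (s + t)) : ℝ) : 𝕜) + ((Real.cos (a * (s - t)) : ℝ) : 𝕜)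
      = 2 * ((Real.cos (a * s) : ℝ) : 𝕜) * ((Real.cos (a * t) : ℝ) : 𝕜) := by
    have : Real.cos (a * (s + t)) + Real.cos (a * (s - t))
        = 2 * Real.cos (a * s) * Real.cos (a * t) := by
      rw [mul_add, mul_sub, Real.cos_add, Real.cos_sub]; ring
    exact_mod_cast congrArg (fun x : ℝ => (x : 𝕜)) this
  have h1 : D (s + t) + D (s - t) = (2 : 𝕜) • (C s * C t)
      - (2 * ((Real.cos (a * s) : ℝ) : 𝕜) * ((Real.cos (a * t) : ℝ) : 𝕜)) • (1 : A) := by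
    rw [hC, ← hcos, hD, hD, add_smul]; abel
  rw [h1, hD s, hD t]
  simp only [mul_sub, sub_mul, smul_mul_assoc, mul_smul_comm, one_mul, mul_one, smul_sub]
  module

lemma cosine_sub_cos_two_mul (C : ℝ → A) (hC0 : C 0 = 1)
    (hC : ∀ s t : ℝ, (2 : 𝕜) • (C s * C t) = C (s + t) + C (s - t)) (a : ℝ) (D : ℝ → A)
    (hD : ∀ t, D t = C t - ((Real.cos (a * t) : ℝ) : 𝕜) • (1 : A)) (t : ℝ) :
    D (2 * t) = (2 : 𝕜) • (D t * D t) + (4 * ((Real.cos (a * t) : ℝ) : 𝕜)) • D t := by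
  have h := cosine_sub_cos_add_add_sub C hC a D hD t t
  have h0 : D 0 = 0 := by simp [hD, hC0]
  rw [sub_self, h0, add_zero, ← two_mul] at h
  rw [h]
  module

/-- A sequence of ring elements, of norms bounded by some `r < 1`, each being the value of
`x ↦ 2 x ^ 2 + 4 x` at the previous one, vanishes. -/
lemma eq_zero_of_forall_succ_eq_two_smul_sq_add (E : ℕ → A)
    (hE : ∀ n, E (n + 1) = (2 : 𝕜) • (E n * E n) + (4 : 𝕜) • E n) {r : ℝ} (hr : r < 1)
    (hb : ∀ n, ‖E n‖ ≤ r) : E 0 = 0 := by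
  have hgrow : ∀ n, 2 * ‖E n‖ ≤ ‖E (n + 1)‖ := by
    intro n
    have h1 : (4 : 𝕜) • E n = E (n + 1) - (2 : 𝕜) • (E n * E n) := by rw [hE]; abel
    have h2 : 4 * ‖E n‖ ≤ ‖E (n + 1)‖ + 2 * ‖E n * E n‖ := by
      have := norm_sub_le (E (n + 1)) ((2 : 𝕜) • (E n * E n))
      rw [← h1, norm_smul, norm_smul] at this
      simpa using this
    nlinarith [norm_mul_le (E n) (E n), norm_nonneg (E n), hb n]
  have hpow : ∀ n : ℕ, 2 ^ n * ‖E 0‖ ≤ ‖E n‖ := by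
    intro n
    induction n with
    | zero => simp
    | succ n ih => rw [pow_succ]; linarith [hgrow n]
  by_contra hne
  have hpos : 0 < ‖E 0‖ := norm_pos_iff.mpr hne
  obtain ⟨n, hn⟩ := pow_unbounded_of_one_lt (1 / ‖E 0‖) (one_lt_two : (1 : ℝ) < 2)
  rw [div_lt_iff₀ hpos] at hn
  linarith [hpow n, hb n]

lemma eq_zero_of_sq_add_smul_eq_zero (x : A) (c : ℝ)
    (hx : (2 : 𝕜) • (x * x) + (4 * (c : 𝕜)) • x = 0) (hlt : ‖x‖ < 2 * |c|) : x = 0 := by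
  have h1 : (4 * (c : 𝕜)) • x = -((2 : 𝕜) • (x * x)) := eq_neg_of_add_eq_zero_right hx
  have h2 := congrArg norm h1
  rw [norm_neg, norm_smul, norm_smul, norm_mul, RCLike.norm_ofReal] at h2
  simp only [RCLike.norm_ofNat] at h2
  by_contra hne
  have hpos : 0 < ‖x‖ := norm_pos_iff.mpr hne
  nlinarith [norm_mul_le x x]

lemma cosine_three_pow_mul_of_sq_eq_zero (C : ℝ → A) (hC0 : C 0 = 1)
    (hC : ∀ s t : ℝ, (2 : 𝕜) • (C s * C t) = C (s + t) + C (s - t)) (t : ℝ)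
    (ht : C t * C t = 0) (k : ℕ) :
    C (3 ^ k * t) = ((-3 : 𝕜) ^ k) • C t := by
  induction k with
  | zero => simp
  | succ k ih =>
    set s := 3 ^ k * t with hs
    have hsq : C s * C s = 0 := by simp [ih, ht]
    have h2 : C (s + s) = -1 := by
      have := hC s s
      rw [hsq, smul_zero, sub_self, hC0] at this
      exact eq_neg_of_add_eq_zero_left this.symm
    have h3 := hC (s + s) s
    rw [h2, add_sub_cancel_right, neg_one_mul] at h3
    have : 3 ^ (k + 1) * t = s + s + s := by rw [hs]; ring
    rw [this, eq_sub_of_add_eq h3.symm, pow_succ', mul_smul, ← ih]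
    module

lemma cosine_eq_zero_of_sq_eq_zero (C : ℝ → A) (hC0 : C 0 = 1)
    (hC : ∀ s t : ℝ, (2 : 𝕜) • (C s * C t) = C (s + t) + C (s - t)) (t M : ℝ)
    (hM : ∀ k : ℕ, ‖C (3 ^ k * t)‖ ≤ M) (ht : C t * C t = 0) : C t = 0 := by
  by_contra hne
  have hpos : 0 < ‖C t‖ := norm_pos_iff.mpr hne
  obtain ⟨k, hk⟩ := pow_unbounded_of_one_lt (M / ‖C t‖) (by norm_num : (1 : ℝ) < 3)
  rw [div_lt_iff₀ hpos] at hk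
  have := hM k
  rw [cosine_three_pow_mul_of_sq_eq_zero C hC0 hC t ht k, norm_smul, norm_pow, norm_neg,
    RCLike.norm_ofNat] at this
  linarith

lemma cosine_sub_cos_nat_mul_eq_zero (C : ℝ → A) (hC0 : C 0 = 1)
    (hC : ∀ s t : ℝ, (2 : 𝕜) • (C s * C t) = C (s + t) + C (s - t)) (a : ℝ) (D : ℝ → A)
    (hD : ∀ t, D t = C t - ((Real.cos (a * t) : ℝ) : 𝕜) • (1 : A)) {t : ℝ} (ht : D t = 0)
    (k : ℕ) : D (k * t) = 0 := by
  suffices h : D (k * t) = 0 ∧ D ((k + 1 : ℕ) * t) = 0 from h.1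
  induction k with
  | zero => simp [ht]; simp [hD, hC0]
  | succ k ih =>
    refine ⟨ih.2, ?_⟩
    have h := cosine_sub_cos_add_add_sub C hC a D hD ((k + 1 : ℕ) * t) t
    have e1 : ((k + 1 : ℕ) : ℝ) * t + t = (k + 1 + 1 : ℕ) * t := by push_cast; ring
    have e2 : ((k + 1 : ℕ) : ℝ) * t - t = k * t := by push_cast; ring
    rw [e1, e2, ih.1, ih.2, ht] at h
    simpa using h

/-- If a cosine family stays at distance at most `r < 1` from `t ↦ cos (a t)`, then it coincides
with it at the points `T / 2 ^ n`, where `a T = 2 π`. -/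
lemma cosine_sub_cos_div_two_pow_eq_zero (C : ℝ → A) (hC0 : C 0 = 1)
    (hC : ∀ s t : ℝ, (2 : 𝕜) • (C s * C t) = C (s + t) + C (s - t)) (a : ℝ) (D : ℝ → A)
    (hD : ∀ t, D t = C t - ((Real.cos (a * t) : ℝ) : 𝕜) • (1 : A)) {r : ℝ} (hr : r < 1)
    (hb : ∀ t, 0 ≤ t → ‖D t‖ ≤ r) {T : ℝ} (hT : 0 ≤ T) (haT : a * T = 2 * Real.pi) (n : ℕ) :
    D (T / 2 ^ n) = 0 := by
  have hdouble := cosine_sub_cos_two_mul C hC0 hC a D hD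
  have hstep : ∀ t, 0 ≤ t → D (2 * t) = 0 → 1 ≤ 2 * |Real.cos (a * t)| → D t = 0 := by
    intro t ht h0 h1
    refine eq_zero_of_sq_add_smul_eq_zero (𝕜 := 𝕜) (D t) (Real.cos (a * t)) ?_ ?_
    · rw [← hdouble, h0]
    · linarith [hb t ht]
  have h0 : D T = 0 := by
    have := eq_zero_of_forall_succ_eq_two_smul_sq_add (𝕜 := 𝕜) (fun n : ℕ => D (2 ^ n * T))
      (fun n => ?_) hr (fun n => hb _ (by positivity))
    · simpa using this
    · have hc : Real.cos (a * (2 ^ n * T)) = 1 := by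
        rw [show a * (2 ^ n * T) = ((2 ^ n : ℕ) : ℝ) * (2 * Real.pi) by
          push_cast; rw [← haT]; ring]
        exact Real.cos_nat_mul_two_pi _
      have := hdouble (2 ^ n * T)
      rw [hc] at this
      simp only [pow_succ', mul_assoc]
      simpa using this
  have h1 : D (T / 2) = 0 := by
    refine hstep _ (by positivity) (by rwa [mul_div_cancel₀ T two_ne_zero]) ?_
    rw [show a * (T / 2) = Real.pi by linarith]
    norm_num
  have h2 : D (T / 4) = 0 := by
    have hc : Real.cos (a * (T / 4)) = 0 := by
      rw [show a * (T / 4) = Real.pi / 2 by linarith, Real.cos_pi_div_two]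
    have hDC : D (T / 4) = C (T / 4) := by simp [hD, hc]
    have hsq : C (T / 4) * C (T / 4) = 0 := by
      have h := hdouble (T / 4)
      rw [hc, show 2 * (T / 4) = T / 2 by ring, h1, hDC] at h
      simpa using h.symm
    rw [hDC]
    refine cosine_eq_zero_of_sq_eq_zero C hC0 hC (T / 4) (r + ‖(1 : A)‖) (fun k => ?_) hsq
    have hk := hD (3 ^ k * (T / 4))
    rw [eq_sub_iff_add_eq] at hk
    rw [← hk]
    refine (norm_add_le _ _).trans (add_le_add (hb _ (by positivity)) ?_)
    rw [norm_smul, RCLike.norm_ofReal]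
    exact mul_le_of_le_one_left (norm_nonneg _) (Real.abs_cos_le_one _)
  have h3 : ∀ m : ℕ, D (T / 2 ^ (m + 2)) = 0 := by
    intro m
    induction m with
    | zero => norm_num [h2]
    | succ m ih =>
      refine hstep _ (by positivity) ?_ ?_
      · rw [← ih]; congr 1; field_simp; ring
      · have hp : (1 : ℝ) ≤ 2 ^ m := one_le_pow₀ one_le_two
        have e : a * (T / 2 ^ (m + 1 + 2)) = Real.pi / 4 / 2 ^ m := by
          rw [← mul_div_assoc, haT]; field_simp; ring
        have hle : Real.pi / 4 / 2 ^ m ≤ Real.pi / 3 := by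
          refine (div_le_self (by positivity) hp).trans ?_
          linarith [Real.pi_pos]
        have hcos := Real.cos_le_cos_of_nonneg_of_le_pi (by positivity)
          (by linarith [Real.pi_pos]) hle
        rw [Real.cos_pi_div_three] at hcos
        rw [e]
        linarith [le_abs_self (Real.cos (Real.pi / 4 / 2 ^ m))]
  match n with
  | 0 => simpa using h0
  | 1 => simpa using h1
  | m + 2 => exact h3 m

end CosineSequences


/-- **Less than one implies zero** (Schwenninger–Zwart).
If `(C t)` is a strongly continuous cosine family on a real or complex Banach space `X`
and `a ≥ 0` is such that `sup_{t ≥ 0} ‖C t - cos(a t)·I‖ < 1`, then `C t = cos(a t)·I`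
for all `t ≥ 0`. -/
theorem less_than_one_implies_zero
    {𝕜 : Type*} [RCLike 𝕜] {X : Type*} [NormedAddCommGroup X] [NormedSpace 𝕜 X]
    [CompleteSpace X]
    (C : ℝ → X →L[𝕜] X)
    (hC0 : C 0 = 1)
    (hCfe : ∀ s t : ℝ, (2 : 𝕜) • (C s).comp (C t) = C (s + t) + C (s - t))
    (hCcont : ∀ x : X, Continuous fun t : ℝ => C t x)
    (a : ℝ) (ha : 0 ≤ a)
    (r : ℝ) (hr : r < 1)
    (hbound : ∀ t : ℝ, 0 ≤ t → ‖C t - ((Real.cos (a * t) : 𝕜)) • (1 : X →L[𝕜] X)‖ ≤ r) :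
    ∀ t : ℝ, 0 ≤ t → C t = ((Real.cos (a * t) : 𝕜)) • (1 : X →L[𝕜] X) := by
  set D : ℝ → X →L[𝕜] X := fun t => C t - ((Real.cos (a * t) : ℝ) : 𝕜) • (1 : X →L[𝕜] X) with hDdef
  have hD : ∀ t, D t = C t - ((Real.cos (a * t) : ℝ) : 𝕜) • (1 : X →L[𝕜] X) := fun _ => rfl
  have hC : ∀ s t : ℝ, (2 : 𝕜) • (C s * C t) = C (s + t) + C (s - t) := hCfe
  suffices h : ∀ t : ℝ, 0 ≤ t → D t = 0 from fun t ht => sub_eq_zero.mp (h t ht)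
  intro t ht
  rcases ha.eq_or_lt with rfl | ha
  · have := eq_zero_of_forall_succ_eq_two_smul_sq_add (𝕜 := 𝕜) (fun n : ℕ => D (2 ^ n * t))
      (fun n => ?_) hr (fun n => hbound _ (by positivity))
    · simpa using this
    · have := cosine_sub_cos_two_mul C hC0 hC 0 D hD (2 ^ n * t)
      rw [zero_mul, Real.cos_zero] at this
      simp only [pow_succ', mul_assoc]
      simpa using this
  · set T := 2 * Real.pi / a with hTdef
    have hT : 0 < T := by positivity
    have haT : a * T = 2 * Real.pi := by rw [hTdef]; field_simp
    have hlim : Tendsto (fun n : ℕ => (⌊t / T * 2 ^ n⌋₊ : ℝ) * (T / 2 ^ n)) atTop (𝓝 t) := by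
      have h := ((tendsto_nat_floor_mul_div_atTop (R := ℝ) (by positivity : 0 ≤ t / T)).comp
        (tendsto_pow_atTop_atTop_of_one_lt (one_lt_two : (1 : ℝ) < 2))).mul_const T
      rw [div_mul_cancel₀ t hT.ne'] at h
      refine h.congr fun n => ?_
      simp only [Function.comp_apply]
      ring
    ext x
    have hcont : Continuous fun s : ℝ => D s x := by
      simp only [hDdef, sub_apply, smul_apply, one_apply_eq_self]
      refine (hCcont x).sub (Continuous.smul ?_ continuous_const)
      exact RCLike.continuous_ofReal.comp (by fun_prop)
    refine tendsto_nhds_unique ((hcont.tendsto t).comp hlim) ?_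
    refine tendsto_const_nhds.congr fun n => ?_
    have h := cosine_sub_cos_nat_mul_eq_zero C hC0 hC a D hD
      (cosine_sub_cos_div_two_pow_eq_zero C hC0 hC a D hD hr hbound hT.le haT n) ⌊t / T * 2 ^ n⌋₊
    simp [h]
end

section
/- If a, b ≥ 0 and a ≠ b, then sup_{t≥0} |cos(at) − cos(bt)| > 1; that is, there exists t ≥ 0 such that |cos(at) − cos(bt)| > 1. -/
/-- If the step `s` lies in `(0, 1/2)`, some odd multiple of `s` falls in `(1/2, 3/2)`. -/
lemma exists_odd_mul_mem_Ioo {s : ℝ} (hs : 0 < s) (hs' : s < 1 / 2) :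
    ∃ k : ℕ, (2 * k + 1 : ℝ) * s ∈ Set.Ioo (1 / 2 : ℝ) (3 / 2) := by
  classical
  have hex : ∃ k : ℕ, 1 / 2 < (2 * k + 1 : ℝ) * s := by
    obtain ⟨k, hk⟩ := exists_nat_gt (1 / s)
    rw [div_lt_iff₀ hs] at hk
    exact ⟨k, by nlinarith⟩
  refine ⟨Nat.find hex, Nat.find_spec hex, ?_⟩
  rcases h : Nat.find hex with _ | m
  · norm_num
    linarith
  · have hm := Nat.find_min hex (m := m) (by omega)
    push_cast
    linarith

lemma exists_one_lt_abs_cos_sub_cos {a b : ℝ} (ha : 0 ≤ a) (hab : a < b) :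
    ∃ t : ℝ, 0 ≤ t ∧ |Real.cos (a * t) - Real.cos (b * t)| > 1 := by
  have hb : 0 < b := ha.trans_lt hab
  have hπ := Real.pi_pos
  rcases lt_trichotomy (2 * a) b with h | h | h
  · refine ⟨Real.pi / b, by positivity, ?_⟩
    have hcos : 0 < Real.cos (a * (Real.pi / b)) := by
      apply Real.cos_pos_of_mem_Ioo
      have : 0 ≤ a * (Real.pi / b) := by positivity
      refine ⟨by linarith, ?_⟩
      rw [← mul_div_assoc, div_lt_iff₀ hb]
      nlinarith
    rw [mul_div_cancel₀ _ hb.ne', Real.cos_pi]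
    exact lt_of_lt_of_le (by linarith) (le_abs_self _)
  · refine ⟨2 * Real.pi / b, by positivity, ?_⟩
    have hat : a * (2 * Real.pi / b) = Real.pi := by
      rw [← h]
      have : a ≠ 0 := by linarith
      field_simp
    rw [hat, mul_div_cancel₀ _ hb.ne', Real.cos_pi, Real.cos_two_pi]
    norm_num
  · obtain ⟨k, hk₁, hk₂⟩ := exists_odd_mul_mem_Ioo (s := (b - a) / b)
      (div_pos (by linarith) hb) (by rw [div_lt_iff₀ hb]; linarith)
    refine ⟨(2 * k + 1) * Real.pi / b, by positivity, ?_⟩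
    have hodd (x : ℝ) : Real.cos ((2 * k + 1) * Real.pi - x) = -Real.cos x := by
      rw [show (2 * k + 1) * Real.pi - x = (Real.pi - x) + k * (2 * Real.pi) by ring,
        Real.cos_add_nat_mul_two_pi, Real.cos_pi_sub]
    have hneg : Real.cos ((2 * k + 1) * ((b - a) / b) * Real.pi) < 0 :=
      Real.cos_neg_of_pi_div_two_lt_of_lt (by nlinarith) (by nlinarith)
    have hat : a * ((2 * k + 1) * Real.pi / b) =
        (2 * k + 1) * Real.pi - (2 * k + 1) * ((b - a) / b) * Real.pi := by
      field_simp
      ring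
    have hbt := hodd 0
    rw [sub_zero, Real.cos_zero] at hbt
    rw [hat, hodd, mul_div_cancel₀ _ hb.ne', hbt]
    exact lt_of_lt_of_le (by linarith) (le_abs_self _)

/-- If `a, b ≥ 0` and `a ≠ b`, then `sup_{t ≥ 0} |cos(a t) - cos(b t)| > 1`:
there is a `t ≥ 0` with `|cos(a t) - cos(b t)| > 1`. -/
theorem sup_abs_cos_sub_cos_gt_one
    (a b : ℝ) (ha : 0 ≤ a) (hb : 0 ≤ b) (hab : a ≠ b) :
    ∃ t : ℝ, 0 ≤ t ∧ |Real.cos (a * t) - Real.cos (b * t)| > 1 := by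
  rcases hab.lt_or_gt with h | h
  · exact exists_one_lt_abs_cos_sub_cos ha h
  · obtain ⟨t, ht, hlt⟩ := exists_one_lt_abs_cos_sub_cos hb h
    exact ⟨t, ht, by rwa [abs_sub_comm]⟩
end

section
/- For every real number a with 0 < a < 1 there exist integers k and m such that 1/4 < k·a − m < 3/4. -/
/-- A step shorter than `1/2` has a multiple in the interval `(1/4, 3/4)`. -/
lemma exists_int_mul_mem_Ioo_of_lt_half {a : ℝ} (ha0 : 0 < a) (ha : a < 1 / 2) :
    ∃ k : ℤ, 1 / 4 < (k : ℝ) * a ∧ (k : ℝ) * a < 3 / 4 := by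
  have h1 := (div_lt_iff₀ ha0).mp (Int.lt_floor_add_one (1 / 4 / a))
  have h2 := (le_div_iff₀ ha0).mp (Int.floor_le (1 / 4 / a))
  refine ⟨⌊1 / 4 / a⌋ + 1, ?_, ?_⟩ <;> push_cast <;> linarith

/-- For every real `a` with `0 < a < 1` there exist integers `k, m` with
`1/4 < k·a - m < 3/4`. -/
theorem exists_int_mul_sub_int_mem_Ioo
    (a : ℝ) (ha0 : 0 < a) (ha1 : a < 1) :
    ∃ k m : ℤ, 1 / 4 < (k : ℝ) * a - m ∧ (k : ℝ) * a - m < 3 / 4 := by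
  rcases lt_trichotomy a (1 / 2) with h | rfl | h
  · obtain ⟨k, hk⟩ := exists_int_mul_mem_Ioo_of_lt_half ha0 h
    exact ⟨k, 0, by simpa using hk⟩
  · exact ⟨1, 0, by norm_num⟩
  · obtain ⟨k, hk₁, hk₂⟩ :=
      exists_int_mul_mem_Ioo_of_lt_half (a := 1 - a) (by linarith) (by linarith)
    refine ⟨-k, -k, ?_, ?_⟩ <;> push_cast <;> linarith
end

section
/- For every natural number n, the limit as q → 0⁺ of q · ∫_0^∞ e^{−qt} |cos(t)|^n dt exists and equals (1/π) · ∫_0^π |cos(t)|^n dt. -/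
open Real MeasureTheory Filter

/-- The Laplace transform of a `T`-periodic function reduces to an integral over one period. -/
theorem one_sub_exp_mul_integral_Ioi_of_periodic {f : ℝ → ℝ} {T : ℝ}
    (hf : Function.Periodic f T) (q : ℝ)
    (hint : ∀ a, IntegrableOn (fun t => Real.exp (-q * t) * f t) (Set.Ioi a)) :
    (1 - Real.exp (-q * T)) * ∫ t in Set.Ioi (0 : ℝ), Real.exp (-q * t) * f t =
      ∫ t in (0 : ℝ)..T, Real.exp (-q * t) * f t := by
  have hshift : ∫ t in Set.Ioi T, Real.exp (-q * t) * f t =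
      Real.exp (-q * T) * ∫ t in Set.Ioi (0 : ℝ), Real.exp (-q * t) * f t := by
    have h := (measurePreserving_add_right volume T).setIntegral_preimage_emb
      (measurableEmbedding_addRight T) (fun t => Real.exp (-q * t) * f t) (Set.Ioi T)
    rw [← h, Set.preimage_add_const_Ioi, sub_self, ← integral_const_mul]
    congr 1 with t
    rw [hf t, mul_add, Real.exp_add]
    ring
  have hsplit := intervalIntegral.integral_interval_add_Ioi (hint 0) (hint T)
  rw [hshift] at hsplit
  linear_combination -hsplit

theorem integrableOn_exp_mul_abs_cos_pow (n : ℕ) {q : ℝ} (hq : 0 < q) (a : ℝ) :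
    IntegrableOn (fun t => Real.exp (-q * t) * |Real.cos t| ^ n) (Set.Ioi a) := by
  refine (exp_neg_integrableOn_Ioi a hq).mul_bdd (c := 1) ?_ ?_
  · exact Continuous.aestronglyMeasurable (by fun_prop)
  · refine Eventually.of_forall fun t => ?_
    rw [Real.norm_of_nonneg (by positivity)]
    exact pow_le_one₀ (abs_nonneg _) (Real.abs_cos_le_one t)

/-- `(1 - e^{-qT}) / q → T` as `q → 0`. -/
theorem tendsto_one_sub_exp_div (T : ℝ) :
    Tendsto (fun q : ℝ => (1 - Real.exp (-q * T)) / q) (nhdsWithin 0 (Set.Ioi 0)) (nhds T) := by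
  have hd : HasDerivAt (fun q : ℝ => 1 - Real.exp (-q * T)) T 0 := by
    have := (((hasDerivAt_id (0 : ℝ)).neg.mul_const T).exp).const_sub 1
    simpa using this
  have := hd.tendsto_slope_zero_right
  simpa [div_eq_inv_mul] using this

/-- For every `n`, `q ∫_0^∞ e^{-qt} |cos t|^n dt → (1/π) ∫_0^π |cos t|^n dt`
as `q → 0⁺`. -/
theorem tendsto_mul_integral_exp_abs_cos_pow
    (n : ℕ) :
    Tendsto (fun q : ℝ => q * ∫ t in Set.Ioi (0 : ℝ), Real.exp (-q * t) * |Real.cos t| ^ n)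
      (nhdsWithin 0 (Set.Ioi 0))
      (nhds ((1 / π) * ∫ t in (0 : ℝ)..π, |Real.cos t| ^ n)) := by
  have hper : Function.Periodic (fun t => |Real.cos t| ^ n) π := fun t => by
    simp [Real.cos_add_pi]
  have hcont : Continuous fun q : ℝ => ∫ t in (0 : ℝ)..π, Real.exp (-q * t) * |Real.cos t| ^ n :=
    intervalIntegral.continuous_parametric_intervalIntegral_of_continuous' (by fun_prop) 0 π
  have hJ : Tendsto (fun q : ℝ => ∫ t in (0 : ℝ)..π, Real.exp (-q * t) * |Real.cos t| ^ n)
      (nhdsWithin 0 (Set.Ioi 0)) (nhds (∫ t in (0 : ℝ)..π, |Real.cos t| ^ n)) := by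
    simpa using (hcont.tendsto 0).mono_left nhdsWithin_le_nhds
  rw [one_div]
  refine (((tendsto_one_sub_exp_div π).inv₀ Real.pi_ne_zero).mul hJ).congr' ?_
  filter_upwards [self_mem_nhdsWithin] with q hq
  have hq : 0 < q := hq
  rw [← one_sub_exp_mul_integral_Ioi_of_periodic hper q
    (integrableOn_exp_mul_abs_cos_pow n hq)]
  have hlt : Real.exp (-q * π) < 1 := by
    rw [Real.exp_lt_one_iff]
    nlinarith [mul_pos hq Real.pi_pos]
  have hne : 1 - Real.exp (-q * π) ≠ 0 := (sub_pos.2 hlt).ne'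
  rw [inv_div, div_mul_eq_mul_div, mul_left_comm, mul_div_cancel_left₀ _ hne]
end

section
/- Let X be a complex Banach space, let A be a bounded linear operator on X, and define the operator cosine function C(t) := Σ_{n=0}^∞ (t^{2n}/(2n)!) A^n for t ∈ ℝ (the series converging in operator norm). Then for every complex λ ≠ 0, every real s, and every x ∈ X, (1/λ) · ∫_0^s sinh(λ(s−t)) · C(t)(λ² I − A) x dt = (cosh(λ s) I − C(s)) x. -/
open MeasureTheory intervalIntegral

section ExponentialType

variable {E : Type*} [NormedAddCommGroup E] [NormedSpace ℂ E] [CompleteSpace E]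

theorem summable_pow_div_factorial_smul {a : ℕ → E} {M r : ℝ}
    (ha : ∀ k, ‖a k‖ ≤ M * r ^ k) (z : ℂ) :
    Summable fun k : ℕ => (z ^ k / (k.factorial : ℂ)) • a k := by
  refine Summable.of_norm_bounded
    (g := fun k => M * ((‖z‖ * r) ^ k / (k.factorial : ℝ)))
    ((Real.summable_pow_div_factorial _).mul_left M) fun k => ?_
  rw [norm_smul, norm_div, norm_pow, Complex.norm_natCast]
  calc ‖z‖ ^ k / (k.factorial : ℝ) * ‖a k‖
      ≤ ‖z‖ ^ k / (k.factorial : ℝ) * (M * r ^ k) := by gcongr; exact ha k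
    _ = M * ((‖z‖ * r) ^ k / (k.factorial : ℝ)) := by rw [mul_pow]; ring

/-- Differentiating a power series of exponential type shifts its coefficients. -/
theorem hasDerivAt_tsum_pow_div_factorial_smul {a : ℕ → E} {M r : ℝ}
    (ha : ∀ k, ‖a k‖ ≤ M * r ^ k) (z : ℂ) :
    HasDerivAt (fun w : ℂ => ∑' k : ℕ, (w ^ k / (k.factorial : ℂ)) • a k)
      (∑' k : ℕ, (z ^ k / (k.factorial : ℂ)) • a (k + 1)) z := by
  have hshift (w : ℂ) (k : ℕ) :
      ((k + 1 : ℕ) : ℂ) * w ^ k / ((k + 1).factorial : ℂ) = w ^ k / (k.factorial : ℂ) := by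
    have h₁ : (k.factorial : ℂ) ≠ 0 := by exact_mod_cast k.factorial_ne_zero
    have h₂ : ((k + 1 : ℕ) : ℂ) ≠ 0 := by exact_mod_cast k.succ_ne_zero
    rw [Nat.factorial_succ, Nat.cast_mul]
    field_simp
  set R : ℝ := ‖z‖ + 1
  have hR : 0 ≤ R := by positivity
  have ha' (k : ℕ) : ‖a (k + 1)‖ ≤ M * r * r ^ k := (ha (k + 1)).trans_eq (by ring)
  let u : ℕ → ℝ := fun k => ‖((k : ℂ) * (R : ℂ) ^ (k - 1) / (k.factorial : ℂ))‖ * ‖a k‖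
  have hu : Summable u := by
    rw [← summable_nat_add_iff 1]
    refine Summable.of_nonneg_of_le (fun k => by positivity) (fun k => ?_)
      ((Real.summable_pow_div_factorial (R * r)).mul_left (M * r))
    simp only [u, Nat.add_sub_cancel, hshift]
    rw [norm_div, norm_pow, Complex.norm_natCast, Complex.norm_real, Real.norm_of_nonneg hR]
    calc R ^ k / (k.factorial : ℝ) * ‖a (k + 1)‖
        ≤ R ^ k / (k.factorial : ℝ) * (M * r * r ^ k) := by gcongr; exact ha' k
      _ = M * r * ((R * r) ^ k / (k.factorial : ℝ)) := by rw [mul_pow]; ring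
  have hz : z ∈ Metric.ball (0 : ℂ) R := by simp [R]
  have hderiv := hasDerivAt_tsum_of_isPreconnected hu Metric.isOpen_ball
    (convex_ball (0 : ℂ) R).isPreconnected
    (g := fun k w => (w ^ k / (k.factorial : ℂ)) • a k)
    (g' := fun k w => ((k : ℂ) * w ^ (k - 1) / (k.factorial : ℂ)) • a k)
    (fun k w _ => ((hasDerivAt_pow k w).div_const _).smul_const (a k))
    (fun k w hw => by
      have hw' : ‖w‖ ≤ R := (mem_ball_zero_iff.mp hw).le
      simp only [u, norm_smul, norm_div, norm_mul, norm_pow, Complex.norm_real,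
        Real.norm_of_nonneg hR]
      gcongr)
    hz (summable_pow_div_factorial_smul ha z) hz
  have hsum : Summable fun k : ℕ =>
      ((k : ℂ) * z ^ (k - 1) / (k.factorial : ℂ)) • a k := by
    rw [← summable_nat_add_iff 1]
    simpa only [Nat.add_sub_cancel, hshift] using summable_pow_div_factorial_smul ha' z
  rw [hsum.tsum_eq_zero_add] at hderiv
  simpa only [Nat.add_sub_cancel, hshift, Nat.cast_zero, zero_mul, zero_div, zero_smul,
    zero_add] using hderiv

end ExponentialType

section CosineFamily

variable {X : Type*} [NormedAddCommGroup X] [NormedSpace ℂ X]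

/-- The Taylor coefficients at `0` of the cosine family generated by `A`. -/
noncomputable def cosineCoeff (A : X →L[ℂ] X) (k : ℕ) : X →L[ℂ] X :=
  if Even k then A ^ (k / 2) else 0

theorem cosineCoeff_add_two (A : X →L[ℂ] X) (k : ℕ) :
    cosineCoeff A (k + 2) = cosineCoeff A k * A := by
  simp [cosineCoeff, Nat.even_add, pow_succ]

theorem norm_cosineCoeff_le (A : X →L[ℂ] X) (k : ℕ) :
    ‖cosineCoeff A k‖ ≤ 1 * max 1 ‖A‖ ^ k := by
  rw [one_mul]
  have h₁ : 1 ≤ max 1 ‖A‖ := le_max_left _ _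
  unfold cosineCoeff
  split_ifs
  · have hpow (n : ℕ) : ‖A ^ n‖ ≤ max 1 ‖A‖ ^ n := by
      rcases n.eq_zero_or_pos with rfl | hn
      · rw [pow_zero, pow_zero]
        exact ContinuousLinearMap.norm_id_le
      · exact (norm_pow_le' A hn).trans (by gcongr; exact le_max_right _ _)
    exact (hpow _).trans (pow_le_pow_right₀ h₁ (Nat.div_le_self _ _))
  · rw [norm_zero]
    positivity

theorem tsum_cosineCoeff (A : X →L[ℂ] X) (z : ℂ) :
    ∑' k : ℕ, (z ^ k / (k.factorial : ℂ)) • cosineCoeff A k =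
      ∑' n : ℕ, (z ^ (2 * n) / ((2 * n).factorial : ℂ)) • A ^ n := by
  have hinj : Function.Injective fun n : ℕ => 2 * n := fun m n h => by
    simpa using h
  rw [← hinj.tsum_eq]
  · simp [cosineCoeff]
  · intro k hk
    by_contra hk'
    refine hk ?_
    have : ¬ Even k := fun ⟨n, hn⟩ => hk' ⟨n, by simp only; omega⟩
    simp [cosineCoeff, this]

end CosineFamily

/-- Sz.-Nagy's identity: for the cosine family `C(t) = Σ (t^{2n}/(2n)!) Aⁿ`
generated by a bounded operator `A` on a complex Banach space,
`(1/λ) ∫_0^s sinh(λ(s-t)) C(t)(λ²I - A)x dt = (cosh(λs) I - C(s)) x`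
for every `λ ≠ 0`, `s ∈ ℝ`, `x ∈ X`. -/
theorem nagy_identity
    {X : Type*} [NormedAddCommGroup X] [NormedSpace ℂ X] [CompleteSpace X]
    (A : X →L[ℂ] X)
    (C : ℝ → X →L[ℂ] X)
    (hC : ∀ t : ℝ, C t = ∑' n : ℕ, (((t : ℂ) ^ (2 * n)) / ((2 * n).factorial : ℂ)) • A ^ n)
    (lam : ℂ) (hlam : lam ≠ 0) (s : ℝ) (x : X) :
    (1 / lam) • ∫ t in (0 : ℝ)..s,
        Complex.sinh (lam * ((s : ℂ) - (t : ℂ))) • (C t) ((lam ^ 2 • (1 : X →L[ℂ] X) - A) x) =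
      Complex.cosh (lam * (s : ℂ)) • x - (C s) x := by
  let c : ℂ → X →L[ℂ] X := fun z => ∑' k : ℕ, (z ^ k / (k.factorial : ℂ)) • cosineCoeff A k
  let d : ℂ → X →L[ℂ] X :=
    fun z => ∑' k : ℕ, (z ^ k / (k.factorial : ℂ)) • cosineCoeff A (k + 1)
  have hCc (t : ℝ) : C t = c t := (hC t).trans (tsum_cosineCoeff A t).symm
  have hbound := norm_cosineCoeff_le A
  have hc (z : ℂ) : HasDerivAt c (d z) z := hasDerivAt_tsum_pow_div_factorial_smul hbound z
  have hd (z : ℂ) : HasDerivAt d (c z * A) z := by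
    have h := hasDerivAt_tsum_pow_div_factorial_smul
      (a := fun k => cosineCoeff A (k + 1)) (M := 1 * max 1 ‖A‖) (r := max 1 ‖A‖)
      (fun k => (hbound (k + 1)).trans_eq (by ring)) z
    simp only [add_assoc, Nat.reduceAdd, cosineCoeff_add_two, ← smul_mul_assoc] at h
    rwa [(summable_pow_div_factorial_smul hbound z).tsum_mul_right] at h
  have hc_zero : c 0 = 1 := by
    refine (tsum_eq_single 0 fun k hk => by simp [hk]).trans ?_
    simp [cosineCoeff]
  have hd_zero : d 0 = 0 := by
    refine (tsum_eq_single 0 fun k hk => by simp [hk]).trans ?_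
    simp [cosineCoeff]
  let F : ℂ → X := fun z => -(lam * Complex.cosh (lam * (s - z))) • c z x
    - Complex.sinh (lam * (s - z)) • d z x
  have hF (z : ℂ) : HasDerivAt F
      (Complex.sinh (lam * (s - z)) • c z ((lam ^ 2 • (1 : X →L[ℂ] X) - A) x)) z := by
    have hlin : HasDerivAt (fun w : ℂ => lam * (s - w)) (-lam) z := by
      simpa using ((hasDerivAt_id z).const_sub (s : ℂ)).const_mul lam
    have hcx : HasDerivAt (fun w => c w x) (d z x) z := by
      simpa using (hc z).clm_apply (hasDerivAt_const z x)
    have hdx : HasDerivAt (fun w => d w x) (c z (A x)) z := by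
      simpa using (hd z).clm_apply (hasDerivAt_const z x)
    refine (((hlin.ccosh.const_mul lam).neg.smul hcx).sub (hlin.csinh.smul hdx)).congr_deriv ?_
    simp only [Pi.neg_apply, sub_apply, smul_apply, one_apply_eq_self, map_sub, map_smul]
    module
  have hc_cont : Continuous c := continuous_iff_continuousAt.2 fun z => (hc z).continuousAt
  have hint : ∫ t in (0 : ℝ)..s, Complex.sinh (lam * ((s : ℂ) - (t : ℂ))) •
      c t ((lam ^ 2 • (1 : X →L[ℂ] X) - A) x) = F s - F (0 : ℝ) := by
    refine integral_eq_sub_of_hasDerivAt (f := fun t : ℝ => F t)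
      (fun t _ => by simpa using! (hF t).scomp t Complex.ofRealCLM.hasDerivAt)
      (Continuous.intervalIntegrable ?_ _ _)
    have := hc_cont.comp Complex.continuous_ofReal
    fun_prop
  simp only [hCc, hint]
  simp only [F, Complex.ofReal_zero, sub_self, sub_zero, mul_zero, Complex.cosh_zero,
    Complex.sinh_zero, hc_zero, hd_zero, zero_apply, smul_zero, zero_smul,
    one_apply_eq_self, mul_one]
  match_scalars <;> field_simp
end

section
/- Let X be a complex Banach space, let A be a bounded linear operator on X, and define C(t) := Σ_{n=0}^∞ (t^{2n}/(2n)!) A^n for t ∈ ℝ. Let a ≥ 0 and suppose there exists r < 1 such that ‖C(t) − cos(at)·I‖ ≤ r for all t ≥ 0 (i.e. sup_{t≥0} ‖C(t) − cos(at)·I‖ < 1). Then the spectrum of A satisfies σ(A) ⊆ {−a²}. -/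
/-- If `cos (2 ^ n * θ)` stays bounded below by a positive constant, then `cos θ = 1`. -/
theorem cos_eq_one_of_forall_le_cos_two_pow_mul {θ δ : ℝ} (hδ : 0 < δ)
    (h : ∀ n : ℕ, δ ≤ Real.cos (2 ^ n * θ)) : Real.cos θ = 1 := by
  have key : ∀ n : ℕ, 2 ^ n * (1 - Real.cos θ) ≤ 1 - Real.cos (2 ^ n * θ) := by
    intro n
    induction n with
    | zero => simp
    | succ n ih =>
      have h1 : (2 : ℝ) ^ (n + 1) * θ = 2 * (2 ^ n * θ) := by ring
      rw [h1, Real.cos_two_mul, pow_succ]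
      nlinarith [h n, Real.cos_le_one (2 ^ n * θ)]
  by_contra hne
  have hpos : 0 < 1 - Real.cos θ := sub_pos.2 (lt_of_le_of_ne (Real.cos_le_one θ) hne)
  obtain ⟨n, hn⟩ := pow_unbounded_of_one_lt (1 / (1 - Real.cos θ)) (one_lt_two (α := ℝ))
  rw [div_lt_iff₀ hpos] at hn
  linarith [key n, h n]

theorem eq_of_abs_cos_sub_cos_le_of_le {a b r : ℝ} (ha : 0 ≤ a) (hab : a ≤ b) (hr : r < 1)
    (h : ∀ t : ℝ, 0 ≤ t → |Real.cos (b * t) - Real.cos (a * t)| ≤ r) : a = b := by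
  rcases (ha.trans hab).eq_or_lt with hb | hb
  · linarith
  have hcos : Real.cos (Real.pi * (1 + a / b)) = 1 := by
    refine cos_eq_one_of_forall_le_cos_two_pow_mul (sub_pos.2 hr) fun n => ?_
    have ht := h ((2 ^ n : ℕ) * Real.pi / b) (by positivity)
    have e1 : b * ((2 ^ n : ℕ) * Real.pi / b) = (2 ^ n : ℕ) * Real.pi := by field_simp
    have e2 : 2 ^ n * (Real.pi * (1 + a / b))
        = a * ((2 ^ n : ℕ) * Real.pi / b) + (2 ^ n : ℕ) * Real.pi := by
      push_cast
      field_simp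
      ring
    rw [e1, Real.cos_nat_mul_pi, abs_le] at ht
    rw [e2, Real.cos_add_nat_mul_pi]
    rcases neg_one_pow_eq_or ℝ (2 ^ n) with hs | hs <;> rw [hs] at ht ⊢ <;> linarith [ht.1, ht.2]
  obtain ⟨m, hm⟩ := (Real.cos_eq_one_iff _).1 hcos
  have hm' : (m : ℝ) * 2 = 1 + a / b :=
    mul_left_cancel₀ Real.pi_ne_zero (by linarith)
  have h0 : 0 ≤ a / b := by positivity
  have h1 : a / b ≤ 1 := (div_le_one hb).2 hab
  have hm0 : (0 : ℝ) < m := by linarith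
  have hm2 : (m : ℝ) < 2 := by linarith
  norm_cast at hm0 hm2
  obtain rfl : m = 1 := by omega
  have h2 : a / b = 1 := by push_cast at hm'; linarith
  exact (div_eq_one_iff_eq hb.ne').1 h2

/-- Two cosine functions at uniform distance less than `1` on the half-line have the same
frequency. -/
theorem abs_eq_abs_of_abs_cos_sub_cos_le {a b r : ℝ} (hr : r < 1)
    (h : ∀ t : ℝ, 0 ≤ t → |Real.cos (b * t) - Real.cos (a * t)| ≤ r) : |b| = |a| := by
  have h' : ∀ t : ℝ, 0 ≤ t → |Real.cos (|b| * t) - Real.cos (|a| * t)| ≤ r := by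
    intro t ht
    have hc : ∀ x : ℝ, Real.cos (|x| * t) = Real.cos (x * t) := fun x => by
      rw [← Real.cos_abs (x * t), abs_mul, abs_of_nonneg ht]
    rw [hc, hc]
    exact h t ht
  rcases le_total |a| |b| with hle | hle
  · exact (eq_of_abs_cos_sub_cos_le_of_le (abs_nonneg a) hle hr h').symm
  · exact eq_of_abs_cos_sub_cos_le_of_le (abs_nonneg b) hle hr fun t ht => by
      rw [abs_sub_comm]
      exact h' t ht

theorem Complex.abs_sinh_re_le_norm_cosh (z : ℂ) : |Real.sinh z.re| ≤ ‖Complex.cosh z‖ := by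
  have h := abs_norm_sub_norm_le (Complex.exp z) (-Complex.exp (-z))
  rw [norm_neg, sub_neg_eq_add, Complex.norm_exp, Complex.norm_exp, Complex.neg_re] at h
  rw [Real.sinh_eq, Complex.cosh, abs_div, norm_div, abs_two, Complex.norm_ofNat]
  gcongr

theorem Complex.re_eq_zero_of_norm_cosh_mul_le {z : ℂ} {K : ℝ}
    (h : ∀ t : ℝ, 0 ≤ t → ‖Complex.cosh (t * z)‖ ≤ K) : z.re = 0 := by
  by_contra hne
  have hz : 0 < |z.re| := abs_pos.2 hne
  have hK : 0 ≤ K := (norm_nonneg _).trans (h 0 le_rfl)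
  have h1 := (Complex.abs_sinh_re_le_norm_cosh _).trans
    (h ((K + 1) / |z.re|) (by positivity))
  rw [Complex.re_ofReal_mul, Real.abs_sinh, abs_mul, abs_of_nonneg (by positivity),
    div_mul_cancel₀ _ hz.ne'] at h1
  have h2 : K + 1 ≤ Real.sinh (K + 1) := Real.self_le_sinh_iff.2 (by positivity)
  linarith

section PowerSeries

variable {R : Type*} [NormedRing R] [NormedAlgebra ℂ R] [CompleteSpace R] [NormOneClass R]

theorem summable_pow_div_factorial_smul_pow (A : R) (t : ℝ) :
    Summable fun n : ℕ => ((t : ℂ) ^ (2 * n) / ((2 * n).factorial : ℂ)) • A ^ n := by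
  refine Summable.of_norm_bounded (Real.hasSum_cosh (|t| * √‖A‖)).summable fun n => ?_
  rw [norm_smul, norm_div, norm_pow, Complex.norm_real, Complex.norm_natCast, Real.norm_eq_abs,
    mul_pow, pow_mul √‖A‖, Real.sq_sqrt (norm_nonneg A), mul_div_right_comm]
  gcongr
  exact norm_pow_le A n

/-- If the power series with coefficients
`c` converges at `A` and at `z ∈ σ(A)`, then the distance from its value at `z` to a scalar `w`
is at most the distance from its value at `A` to `w`. -/
theorem spectrum.norm_sub_le_of_hasSum {A S : R} {c : ℕ → ℂ} {z s : ℂ} (w : ℂ)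
    (hz : z ∈ spectrum ℂ A) (hA : HasSum (fun n => c n • A ^ n) S)
    (hs : HasSum (fun n => c n * z ^ n) s) : ‖s - w‖ ≤ ‖S - w • (1 : R)‖ := by
  refine le_of_tendsto_of_tendsto' (hs.tendsto_sum_nat.sub_const w).norm
    (hA.tendsto_sum_nat.sub_const (w • (1 : R))).norm fun N => ?_
  let p : Polynomial ℂ :=
    ∑ n ∈ Finset.range N, Polynomial.C (c n) * Polynomial.X ^ n - Polynomial.C w
  have hp := spectrum.norm_le_norm_of_mem (spectrum.subset_polynomial_aeval A p ⟨z, hz, rfl⟩)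
  simpa [p, Polynomial.eval_finsetSum, Algebra.algebraMap_eq_smul_one] using hp

end PowerSeries


/-- If the cosine family `C(t) = Σ (t^{2n}/(2n)!) Aⁿ` generated by a bounded operator `A`
on a complex Banach space satisfies `sup_{t ≥ 0} ‖C(t) - cos(at)·I‖ < 1` for some `a ≥ 0`,
then `σ(A) ⊆ {-a²}`. -/
theorem spectrum_subset_of_cosine_close
    {X : Type*} [NormedAddCommGroup X] [NormedSpace ℂ X] [CompleteSpace X]
    (A : X →L[ℂ] X)
    (C : ℝ → X →L[ℂ] X)
    (hC : ∀ t : ℝ, C t = ∑' n : ℕ, (((t : ℂ) ^ (2 * n)) / ((2 * n).factorial : ℂ)) • A ^ n)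
    (a : ℝ) (ha : 0 ≤ a)
    (r : ℝ) (hr : r < 1)
    (hbound : ∀ t : ℝ, 0 ≤ t →
      ‖C t - ((Real.cos (a * t) : ℂ)) • (1 : X →L[ℂ] X)‖ ≤ r) :
    spectrum ℂ A ⊆ {-(a : ℂ) ^ 2} := by
  intro z hz
  have : Nontrivial X := by
    by_contra hX
    rw [not_nontrivial_iff_subsingleton] at hX
    simp [spectrum.of_subsingleton] at hz
  obtain ⟨w, rfl⟩ := IsAlgClosed.exists_pow_nat_eq z two_pos
  have hclose : ∀ t : ℝ, 0 ≤ t → ‖Complex.cosh (t * w) - (Real.cos (a * t) : ℂ)‖ ≤ r := by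
    intro t ht
    have hA := (summable_pow_div_factorial_smul_pow A t).hasSum
    rw [← hC t] at hA
    refine (spectrum.norm_sub_le_of_hasSum _ hz hA ?_).trans (hbound t ht)
    convert Complex.hasSum_cosh (t * w) using 2 with n
    rw [mul_pow, pow_mul w, mul_div_right_comm]
  have hre : w.re = 0 := by
    refine Complex.re_eq_zero_of_norm_cosh_mul_le (K := r + 1) fun t ht => ?_
    have hcos : ‖(Real.cos (a * t) : ℂ)‖ ≤ 1 := by
      rw [Complex.norm_real]
      exact Real.abs_cos_le_one _
    linarith [hclose t ht, norm_le_norm_sub_add (Complex.cosh (t * w)) (Real.cos (a * t) : ℂ)]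
  have hw : w = w.im * Complex.I := Complex.ext (by simp [hre]) (by simp)
  have him : |w.im| = |a| := by
    refine abs_eq_abs_of_abs_cos_sub_cos_le hr fun t ht => ?_
    have e : Complex.cosh (t * w) = (Real.cos (w.im * t) : ℂ) := by
      conv_lhs => rw [hw]
      rw [← mul_assoc, Complex.cosh_mul_I, mul_comm (t : ℂ)]
      push_cast
      rfl
    have h := hclose t ht
    rwa [e, ← Complex.ofReal_sub, Complex.norm_real, Real.norm_eq_abs] at h
  have hsq : (w.im : ℂ) ^ 2 = (a : ℂ) ^ 2 := by exact_mod_cast (sq_eq_sq_iff_abs_eq_abs _ _).2 him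
  rw [Set.mem_singleton_iff, hw, mul_pow, Complex.I_sq, hsq]
  ring
end
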